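/- Let d ≥ 3, σ ≥ 0 and n > σ with n − σ > (3/4)·d·2^d − 2d, let 0 < Δ < d/3 and i ∈ {1, 2}. Then there exists δ > 0, depending only on d, n and Δ, such that for all P ≥ 2: Σ_{q : P^{γᵢ} ≤ η_q ≤ P^γ} ∫_{ {α ∈ 𝕋 : P^{−dᵢ} ≤ ‖qα‖ ≤ P^{−ξ}} } min{ η_q^{−1}, ‖qα‖^{1/(B₃ + V₃)} }^{n−σ} dα ≪ P^{−d−δ}, where d₁ := d + 2, d₂ := d − Δ, γ₁ := Δ/(5·2^{d−2} − 4), γ₂ := 0. -/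

import Mathlib

noncomputable section
open scoped Classical
open MvPolynomial MeasureTheory

/-- Distance from a real number to the nearest integer. -/
def nint (x : ℝ) : ℝ := |x - round x|

/-- `α ∈ 𝕋` and `q ∈ ℕ` are *primitive* if there is `a` coprime to `q`
with `‖qα‖ = |qα - a|`. -/
def Primitive (α : ℝ) (q : ℕ) : Prop :=
  ∃ a : ℤ, Int.gcd a q = 1 ∧ nint (q * α) = |q * α - a|

/-- `e(t) = exp(2πit)`. -/
def eC (t : ℝ) : ℂ := Complex.exp (2 * Real.pi * Complex.I * t)

/-- The exponential sum `S(α, P) = Σ_{x ∈ ℤⁿ} ω(x/P) e(α f(x))`. -/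
def expSum (n : ℕ) (f : MvPolynomial (Fin n) ℤ) (ω : (Fin n → ℝ) → ℝ) (α P : ℝ) : ℂ :=
  ∑' x : Fin n → ℤ, (ω (fun i => (x i : ℝ) / P) : ℂ) * eC (α * (MvPolynomial.eval x f : ℝ))

/-- Mixed partial derivative `∂^ε g`. -/
def mpderiv (n : ℕ) (ε : Fin n → ℕ) (g : (Fin n → ℝ) → ℝ) : (Fin n → ℝ) → ℝ :=
  (List.finRange n).foldr
    (fun i h => (fun u : (Fin n → ℝ) → ℝ => fun x => fderiv ℝ u x (Pi.single i 1))^[ε i] h) g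

/-- A super-exponential increasing tuple of positive constants `(c, c₀, c₁, …)`. -/
def SuperSeq (c : ℝ) (cs : ℕ → ℝ) : Prop :=
  0 < c ∧ c ≤ cs 0 ∧ Monotone cs ∧ ∀ i j, cs i * cs j ≤ cs (i + j)

/-- Membership of `ω` in the class `𝒮⁺(𝐜)` of smooth weight functions. -/
def SmoothWeight (n : ℕ) (c : ℝ) (cs : ℕ → ℝ) (ω : (Fin n → ℝ) → ℝ) : Prop :=
  ContDiff ℝ (⊤ : ℕ∞) ω ∧ (∀ x, 0 ≤ ω x) ∧ (∀ x, ω x ≠ 0 → ∀ i, |x i| ≤ c) ∧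
    ∀ (ε : Fin n → ℕ) (x : Fin n → ℝ), |mpderiv n ε ω x| ≤ cs (∑ i, ε i)

/-- Dimension of the singular locus of `g` over `K`, i.e. the Krull dimension
of the coordinate ring of the affine set cut out by `∇g = 0`. -/
def singDim (n : ℕ) (K : Type) [CommRing K] (g : MvPolynomial (Fin n) K) : WithBot (WithTop ℕ) :=
  ringKrullDim (MvPolynomial (Fin n) K ⧸ Ideal.span (Set.range fun i => MvPolynomial.pderiv i g))

/-- `Height f ≤ H`: all coefficients of `f` are at most `H` in absolute value. -/
def HeightLe (n : ℕ) (f : MvPolynomial (Fin n) ℤ) (H : ℝ) : Prop :=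
  ∀ m : Fin n →₀ ℕ, |((f.coeff m : ℤ) : ℝ)| ≤ H

/-- `Height_{P,k} f ≤ H`: the relative height of `f` w.r.t. `P` at scale `k` is at most `H`. -/
def HeightPLe (n k : ℕ) (P : ℝ) (f : MvPolynomial (Fin n) ℤ) (H : ℝ) : Prop :=
  ∀ m : Fin n →₀ ℕ, |((f.coeff m : ℤ) : ℝ)| * P ^ (m.sum fun _ e => e) ≤ H * P ^ k

/-- `b = ∏_{p^e ∥ q, e ≤ 2} p^e`. -/
def bOf (q : ℕ) : ℕ :=
  ∏ p ∈ q.primeFactors, if q.factorization p ≤ 2 then p ^ q.factorization p else 1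

/-- `c₁ = ∏_{p^e ∥ q, e > 2} p^⌊e/2⌋`. -/
def c1Of (q : ℕ) : ℕ :=
  ∏ p ∈ q.primeFactors, if 2 < q.factorization p then p ^ (q.factorization p / 2) else 1

/-- `c₂ = ∏_{p^e ∥ q, e > 2, e odd} p`. -/
def c2Of (q : ℕ) : ℕ :=
  ∏ p ∈ q.primeFactors, if 2 < q.factorization p ∧ Odd (q.factorization p) then p else 1

/-- `η_q = max{(b³c₁c₂²)^{1/(2^d−2)}, (b³c₁²c₂)^{1/(5·2^{d−2}−4)}}`. -/
def etaOf (d q : ℕ) : ℝ :=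
  max (((bOf q : ℝ) ^ 3 * (c1Of q : ℝ) * (c2Of q : ℝ) ^ 2) ^ ((1 : ℝ) / ((2:ℝ) ^ (d : ℝ) - 2)))
      (((bOf q : ℝ) ^ 3 * (c1Of q : ℝ) ^ 2 * (c2Of q : ℝ)) ^
        ((1 : ℝ) / (5 * (2:ℝ) ^ ((d : ℝ) - 2) - 4)))

/-- The `r`-values `r_i = ∏_{p^e ∥ kb, σ_p(g^{[k]}) = i} p^e` of `g` w.r.t. `q`. -/
def rOf (n k q : ℕ) (g : MvPolynomial (Fin n) ℤ) (i : ℕ) : ℕ :=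
  ∏ p ∈ (k * bOf q).primeFactors,
    if singDim n (ZMod p)
        (MvPolynomial.map (Int.castRingHom (ZMod p)) (MvPolynomial.homogeneousComponent k g))
        = (i : WithBot (WithTop ℕ))
    then p ^ ((k * bOf q).factorization p) else 1

/-- `R^{[k]}_ζ(g, q) = ∏_{ζ ≤ i ≤ n} r_i^{i−ζ}`. -/
def ROf (n k q : ℕ) (g : MvPolynomial (Fin n) ℤ) (ζ : ℕ) : ℕ :=
  ∏ i ∈ Finset.Icc ζ n, (rOf n k q g i) ^ (i - ζ)

/-- `ξ = (5 − 2^{4−d})/(3 − 2^{3−d})`. -/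
def xiOf (d : ℕ) : ℝ := (5 - (2:ℝ) ^ ((4 : ℝ) - d)) / (3 - (2:ℝ) ^ ((3 : ℝ) - d))

/-- `γ = 1/(3·2^{d−2} − 2)`. -/
def gamOf (d : ℕ) : ℝ := 1 / (3 * (2:ℝ) ^ ((d : ℝ) - 2) - 2)

/-- `A_d = 7·2^{d−4} − 5/4`. -/
def AdOf (d : ℕ) : ℝ := 7 * (2:ℝ) ^ ((d : ℝ) - 4) - 5 / 4

/-- `B_k = (k−1)·2^{d−1}`. -/
def BkOf (d k : ℕ) : ℝ := ((k : ℝ) - 1) * (2:ℝ) ^ ((d : ℝ) - 1)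

/-- `V_k = 2^{d+1−k} − 2`. -/
def VkOf (d k : ℕ) : ℝ := (2:ℝ) ^ ((d : ℝ) + 1 - (k : ℝ)) - 2

/-- `C(α, q) = (‖qα‖P)^{1/(2^{d−1}−2)} + (qP^{−2})^{1/2^{d−2}} + η_q⁻¹`. -/
def CCof (d : ℕ) (P : ℝ) (q : ℕ) (α : ℝ) : ℝ :=
  (nint (q * α) * P) ^ (1 / ((2:ℝ) ^ ((d : ℝ) - 1) - 2)) +
    ((q : ℝ) * P ^ (-(2 : ℝ))) ^ (1 / (2:ℝ) ^ ((d : ℝ) - 2)) + (etaOf d q)⁻¹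

/-- `W_k(α, q)`; the term `(‖qα‖P^k)^{−1/B_k}` is interpreted as `+∞` when `‖qα‖ = 0`. -/
def WWof (d k : ℕ) (P : ℝ) (q : ℕ) (α : ℝ) : ℝ :=
  P ^ (-((2:ℝ) ^ (1 - (d : ℝ)))) + nint (q * α) ^ (1 / (BkOf d k + VkOf d k)) +
    ((q : ℝ) * P ^ (-(k : ℝ))) ^ (1 / BkOf d k) +
    min ((q : ℝ) ^ (-(1 / (BkOf d k + VkOf d k))))
      (if nint (q * α) = 0 then (q : ℝ) ^ (-(1 / (BkOf d k + VkOf d k)))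
       else (nint (q * α) * P ^ (k : ℝ)) ^ (-(1 / BkOf d k)))

/-- `M(α, q) = min{C(α, q), W₃(α, q), …, W_d(α, q)}`. -/
def MMof (d : ℕ) (P : ℝ) (q : ℕ) (α : ℝ) : ℝ :=
  min (CCof d P q α) (sInf ((fun k => WWof d k P q α) '' Set.Icc 3 d))

/-- `W_k*(α, q)`; the term `(‖qα‖P^k)^{−1/B_k}` is interpreted as `+∞` when `‖qα‖ = 0`. -/
def WSof (d k : ℕ) (P : ℝ) (q : ℕ) (α : ℝ) : ℝ :=
  max (nint (q * α) ^ (1 / (BkOf d k + VkOf d k)))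
    (min ((etaOf d q)⁻¹)
      (if nint (q * α) = 0 then (etaOf d q)⁻¹
       else (nint (q * α) * P ^ (k : ℝ)) ^ (-(1 / BkOf d k))))

/-- `M*(α, q) = min{W₃*(α, q), …, W_d*(α, q)}`. -/
def MSof (d : ℕ) (P : ℝ) (q : ℕ) (α : ℝ) : ℝ :=
  sInf ((fun k => WSof d k P q α) '' Set.Icc 3 d)

/-- The major arcs `𝔐(Δ)`, viewed inside a fundamental domain `[0,1)` for `𝕋 = ℝ/ℤ`. -/
def majorArcs (d : ℕ) (Δ P : ℝ) : Set ℝ :=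
  {α | ∃ q : ℕ, 0 < q ∧ (q : ℝ) ≤ P ^ Δ ∧
    ∃ a : ℕ, a ≤ q ∧ Nat.gcd a q = 1 ∧ nint (α - (a : ℝ) / q) ≤ P ^ (Δ - d)}

/-- The minor arcs `𝔪 = 𝕋 ∖ 𝔐(Δ)`. -/
def minorArcs (d : ℕ) (Δ P : ℝ) : Set ℝ := Set.Ico (0 : ℝ) 1 \ majorArcs d Δ P

theorem nint_nonneg (x : ℝ) : 0 ≤ nint x := abs_nonneg _

theorem bOf_pos (q : ℕ) : 0 < bOf q := by
  refine Finset.prod_pos fun p hp => ?_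
  have := (Nat.prime_of_mem_primeFactors hp).pos
  split_ifs <;> positivity

theorem c1Of_pos (q : ℕ) : 0 < c1Of q := by
  refine Finset.prod_pos fun p hp => ?_
  have := (Nat.prime_of_mem_primeFactors hp).pos
  split_ifs <;> positivity

theorem c2Of_pos (q : ℕ) : 0 < c2Of q := by
  refine Finset.prod_pos fun p hp => ?_
  have := (Nat.prime_of_mem_primeFactors hp).pos
  split_ifs <;> positivity

theorem bOf_mul_c1Of_sq_mul_c2Of {q : ℕ} (hq : q ≠ 0) :
    bOf q * c1Of q ^ 2 * c2Of q = q := by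
  conv_rhs => rw [← Nat.prod_factorization_pow_eq_self hq]
  rw [Nat.prod_factorization_eq_prod_primeFactors, bOf, c1Of, c2Of, ← Finset.prod_pow,
    ← Finset.prod_mul_distrib, ← Finset.prod_mul_distrib]
  refine Finset.prod_congr rfl fun p _ => ?_
  generalize q.factorization p = e
  rcases le_or_gt e 2 with h | h
  · simp [h, h.not_gt]
  · rcases Nat.even_or_odd e with he | he
    · have : ¬ Odd e := by simpa using he
      simp only [h.not_ge, h, this, if_true, if_false, and_false, one_mul, mul_one, ← pow_mul]
      rw [Nat.div_mul_cancel he.two_dvd]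
    · simp only [h.not_ge, h, he, if_true, if_false, and_self, one_mul, ← pow_mul, ← pow_succ]
      rw [Nat.div_two_mul_two_add_one_of_odd he]

/-- The triple `(b, c₁, c₂)` determines `q`, so a convergent triple series dominates. -/
theorem summable_bOf_c1Of_c2Of {a : ℝ} (ha : 1 < a) :
    Summable fun q : ℕ => ((bOf q : ℝ) * c1Of q * c2Of q) ^ (-a) := by
  have h1 : Summable fun m : ℕ => (m : ℝ) ^ (-a) := Real.summable_nat_rpow.2 (by linarith)
  have h0 : 0 ≤ fun m : ℕ => (m : ℝ) ^ (-a) := fun m => by positivity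
  have h3 := (h1.mul_of_nonneg h1 h0 h0).mul_of_nonneg h1 (fun x => by positivity) h0
  rw [← summable_nat_add_iff 1]
  have hinj : Function.Injective fun q : ℕ =>
      ((bOf (q + 1), c1Of (q + 1)), c2Of (q + 1)) := by
    intro q r h
    simp only [Prod.mk.injEq] at h
    have hq := bOf_mul_c1Of_sq_mul_c2Of q.succ_ne_zero
    have hr := bOf_mul_c1Of_sq_mul_c2Of r.succ_ne_zero
    simp only [Nat.succ_eq_add_one] at hq hr
    rw [h.1.1, h.1.2, h.2, hr] at hq
    omega
  refine (h3.comp_injective hinj).congr fun q => ?_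
  simp only [Function.comp_apply]
  rw [Real.mul_rpow (by positivity) (by positivity),
    Real.mul_rpow (by positivity) (by positivity)]

theorem two_rpow_natCast_sub_two {d : ℕ} (hd : 3 ≤ d) :
    2 ≤ (2 : ℝ) ^ ((d : ℝ) - 2) ∧ (d : ℝ) - 1 ≤ (2 : ℝ) ^ ((d : ℝ) - 2) := by
  obtain ⟨k, rfl⟩ := Nat.exists_eq_add_of_le hd
  have e : (2 : ℝ) ^ (((3 + k : ℕ) : ℝ) - 2) = 2 * 2 ^ k := by
    rw [show ((3 + k : ℕ) : ℝ) - 2 = ((k + 1 : ℕ) : ℝ) by push_cast; ring, Real.rpow_natCast,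
      pow_succ']
  have h2 : (k : ℝ) + 1 ≤ 2 ^ k := by exact_mod_cast Nat.lt_two_pow_self
  have h3 : (0 : ℝ) ≤ k := by positivity
  rw [e]
  push_cast
  constructor <;> linarith

theorem two_rpow_eq_four_mul (x : ℝ) : (2 : ℝ) ^ x = 4 * 2 ^ (x - 2) := by
  rw [Real.rpow_sub two_pos]; norm_num; ring

theorem etaOf_pos (d q : ℕ) : 0 < etaOf d q := by
  have := bOf_pos q
  have := c1Of_pos q
  have := c2Of_pos q
  exact lt_max_of_lt_left (by positivity)

theorem le_etaOf_rpow {d : ℕ} (hd : 3 ≤ d) (q : ℕ) :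
    (bOf q : ℝ) * c1Of q * c2Of q ≤ etaOf d q ^ (3 * (2 : ℝ) ^ ((d : ℝ) - 2) - 2) := by
  have hM := (two_rpow_natCast_sub_two hd).1
  have hη := etaOf_pos d q
  have hb : (1 : ℝ) ≤ bOf q := by exact_mod_cast bOf_pos q
  have hc1 : (0 : ℝ) < c1Of q := by exact_mod_cast c1Of_pos q
  have hc2 : (0 : ℝ) < c2Of q := by exact_mod_cast c2Of_pos q
  have h1 := le_max_left
    (((bOf q : ℝ) ^ 3 * (c1Of q : ℝ) * (c2Of q : ℝ) ^ 2) ^ ((1 : ℝ) / ((2:ℝ) ^ (d : ℝ) - 2)))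
    (((bOf q : ℝ) ^ 3 * (c1Of q : ℝ) ^ 2 * (c2Of q : ℝ)) ^
        ((1 : ℝ) / (5 * (2:ℝ) ^ ((d : ℝ) - 2) - 4)))
  have h2 := le_max_right
    (((bOf q : ℝ) ^ 3 * (c1Of q : ℝ) * (c2Of q : ℝ) ^ 2) ^ ((1 : ℝ) / ((2:ℝ) ^ (d : ℝ) - 2)))
    (((bOf q : ℝ) ^ 3 * (c1Of q : ℝ) ^ 2 * (c2Of q : ℝ)) ^
        ((1 : ℝ) / (5 * (2:ℝ) ^ ((d : ℝ) - 2) - 4)))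
  change _ ≤ etaOf d q at h1 h2
  rw [two_rpow_eq_four_mul d] at h1
  generalize (2 : ℝ) ^ ((d : ℝ) - 2) = M at *
  rw [one_div, Real.rpow_inv_le_iff_of_pos (by positivity) hη.le (by linarith)] at h1 h2
  refine le_of_pow_le_pow_left₀ three_ne_zero (by positivity) ?_
  calc ((bOf q : ℝ) * c1Of q * c2Of q) ^ 3
      ≤ (bOf q : ℝ) ^ 3 * ((bOf q : ℝ) * c1Of q * c2Of q) ^ 3 :=
        le_mul_of_one_le_left (by positivity) (one_le_pow₀ hb)
    _ = ((bOf q : ℝ) ^ 3 * (c1Of q : ℝ) * (c2Of q : ℝ) ^ 2) *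
          ((bOf q : ℝ) ^ 3 * (c1Of q : ℝ) ^ 2 * (c2Of q : ℝ)) := by ring
    _ ≤ etaOf d q ^ (4 * M - 2) * etaOf d q ^ (5 * M - 4) := by gcongr
    _ = (etaOf d q ^ (3 * M - 2)) ^ 3 := by
        rw [← Real.rpow_add hη, ← Real.rpow_mul_natCast hη.le]
        congr 1
        push_cast
        ring

theorem volume_nint_le {q : ℕ} (hq : 0 < q) {τ : ℝ} (hτ : 0 ≤ τ) :
    volume {α : ℝ | α ∈ Set.Ico (0 : ℝ) 1 ∧ nint (q * α) ≤ τ} ≤ ENNReal.ofReal (4 * τ) := by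
  have hq' : (1 : ℝ) ≤ q := by exact_mod_cast hq
  have hsub : {α : ℝ | α ∈ Set.Ico (0 : ℝ) 1 ∧ nint (q * α) ≤ τ} ⊆
      ⋃ a ∈ Finset.range (q + 1), Set.Icc ((a : ℝ) / q - τ / q) ((a : ℝ) / q + τ / q) := by
    rintro α ⟨⟨h0, h1⟩, h2⟩
    have hr0 : 0 ≤ round ((q : ℝ) * α) := by
      rw [round_eq]
      exact Int.floor_nonneg.2 (by positivity)
    have hr1 : round ((q : ℝ) * α) ≤ q := by
      rw [round_eq, ← Int.lt_add_one_iff, Int.floor_lt]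
      push_cast
      nlinarith
    obtain ⟨a, ha⟩ := Int.eq_ofNat_of_zero_le hr0
    rw [ha] at hr1
    rw [nint, ha, abs_le] at h2
    simp only [Int.cast_natCast] at h2
    simp only [Set.mem_iUnion, Finset.mem_range, Set.mem_Icc]
    refine ⟨a, by omega, ?_, ?_⟩
    · rw [← sub_div, div_le_iff₀ (by positivity)]; linarith
    · rw [← add_div, le_div_iff₀ (by positivity)]; linarith
  calc _ ≤ volume (⋃ a ∈ Finset.range (q + 1),
            Set.Icc ((a : ℝ) / q - τ / q) ((a : ℝ) / q + τ / q)) := measure_mono hsub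
    _ ≤ ∑ a ∈ Finset.range (q + 1),
          volume (Set.Icc ((a : ℝ) / q - τ / q) ((a : ℝ) / q + τ / q)) :=
        measure_biUnion_finset_le _ _
    _ = ENNReal.ofReal ((q + 1) * (2 * (τ / q))) := by
        rw [ENNReal.ofReal_mul (by positivity)]
        simp only [Real.volume_Icc, add_sub_sub_cancel, Finset.sum_const, Finset.card_range,
          nsmul_eq_mul, ← two_mul]
        congr 1
        rw [← Nat.cast_add_one, ENNReal.ofReal_natCast]
    _ ≤ ENNReal.ofReal (4 * τ) := by
        refine ENNReal.ofReal_le_ofReal ?_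
        rw [← mul_div_assoc, ← mul_div_assoc, div_le_iff₀ (by positivity)]
        nlinarith

theorem integral_min_rpow_le {q : ℕ} (hq : 0 < q) {τ l η e N s : ℝ} (hτ : 0 ≤ τ) (hη : 0 < η)
    (he : 0 ≤ e) (hs : 0 ≤ s) (hsN : s ≤ N) :
    ∫ α in {α : ℝ | α ∈ Set.Ico (0 : ℝ) 1 ∧ l ≤ nint (q * α) ∧ nint (q * α) ≤ τ},
      (min η⁻¹ (nint (q * α) ^ e)) ^ N ≤ 4 * (τ * τ ^ (e * (N - s)) * η ^ (-s)) := by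
  set T := {α : ℝ | α ∈ Set.Ico (0 : ℝ) 1 ∧ l ≤ nint (q * α) ∧ nint (q * α) ≤ τ}
  have hT : volume T ≤ ENNReal.ofReal (4 * τ) :=
    (measure_mono (t := {α : ℝ | α ∈ Set.Ico (0 : ℝ) 1 ∧ nint (q * α) ≤ τ})
      fun α hα => ⟨hα.1, hα.2.2⟩).trans (volume_nint_le hq hτ)
  have hbound : ∀ α ∈ T,
      ‖(min η⁻¹ (nint (q * α) ^ e)) ^ N‖ ≤ η ^ (-s) * τ ^ (e * (N - s)) := by
    rintro α ⟨-, -, hα⟩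
    have hn := nint_nonneg (q * α)
    have hm : 0 ≤ min η⁻¹ (nint (q * α) ^ e) := by positivity
    rw [Real.norm_of_nonneg (by positivity)]
    calc (min η⁻¹ (nint (q * α) ^ e)) ^ N
        = (min η⁻¹ (nint (q * α) ^ e)) ^ s * (min η⁻¹ (nint (q * α) ^ e)) ^ (N - s) := by
          rw [← Real.rpow_add_of_nonneg hm hs (by linarith), add_sub_cancel]
      _ ≤ η⁻¹ ^ s * (τ ^ e) ^ (N - s) := by
          gcongr
          · exact min_le_left _ _
          · exact (min_le_right _ _).trans (by gcongr)
      _ = η ^ (-s) * τ ^ (e * (N - s)) := by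
          rw [Real.inv_rpow hη.le, ← Real.rpow_neg hη.le, ← Real.rpow_mul hτ]
  calc _ ≤ η ^ (-s) * τ ^ (e * (N - s)) * volume.real T :=
        (Real.le_norm_self _).trans
          (norm_setIntegral_le_of_norm_le_const (hT.trans_lt ENNReal.ofReal_lt_top) hbound)
    _ ≤ η ^ (-s) * τ ^ (e * (N - s)) * (4 * τ) := by
        gcongr
        exact ENNReal.toReal_le_of_le_ofReal (by positivity) hT
    _ = _ := by ring

theorem xiOf_eq (d : ℕ) :
    xiOf d = (5 * (2 : ℝ) ^ ((d : ℝ) - 2) - 4) / (3 * (2 : ℝ) ^ ((d : ℝ) - 2) - 2) := by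
  have hM : (0 : ℝ) < 2 ^ ((d : ℝ) - 2) := by positivity
  have e1 : (2 : ℝ) ^ ((4 : ℝ) - d) = 4 / 2 ^ ((d : ℝ) - 2) := by
    rw [show (4 : ℝ) - d = 2 - ((d : ℝ) - 2) by ring, Real.rpow_sub two_pos]; norm_num
  have e2 : (2 : ℝ) ^ ((3 : ℝ) - d) = 2 / 2 ^ ((d : ℝ) - 2) := by
    rw [show (3 : ℝ) - d = 1 - ((d : ℝ) - 2) by ring, Real.rpow_sub two_pos]; norm_num
  rw [xiOf, e1, e2, ← mul_div_mul_right _ _ hM.ne', sub_mul, sub_mul, div_mul_cancel₀ _ hM.ne',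
    div_mul_cancel₀ _ hM.ne']

theorem BkOf_add_VkOf_three (d : ℕ) :
    BkOf d 3 + VkOf d 3 = 5 * (2 : ℝ) ^ ((d : ℝ) - 2) - 2 := by
  have e : (2 : ℝ) ^ ((d : ℝ) - 1) = 2 * 2 ^ ((d : ℝ) - 2) := by
    rw [show (d : ℝ) - 1 = 1 + ((d : ℝ) - 2) by ring, Real.rpow_add two_pos, Real.rpow_one]
  rw [BkOf, VkOf, e]
  push_cast
  rw [show (d : ℝ) + 1 - 3 = (d : ℝ) - 2 by ring]
  ring

/-- With `M = 2^(d-2)`, the total saving in `P` exceeds `d`. -/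
theorem lt_saving_exponent {d M x : ℝ} (hM : 2 ≤ M) (hdM : d - 1 ≤ M)
    (hx : (d - 1) * (3 * M - 2) < x) :
    d < (5 * M - 4) / (3 * M - 2) * (1 + 1 / (5 * M - 2) * x) := by
  have h3 : 0 < 3 * M - 2 := by linarith
  have h5 : 0 < 5 * M - 2 := by linarith
  have h4 : 0 < 5 * M - 4 := by linarith
  have key : d ≤ (5 * M - 4) / (3 * M - 2) * (1 + 1 / (5 * M - 2) * ((d - 1) * (3 * M - 2))) := by
    have e : (5 * M - 4) / (3 * M - 2) * (1 + 1 / (5 * M - 2) * ((d - 1) * (3 * M - 2))) - d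
        = 2 * ((M - 1) * (5 * M - 2) - (d - 1) * (3 * M - 2)) /
          ((3 * M - 2) * (5 * M - 2)) := by
      obtain ⟨u, hu⟩ : ∃ u, 3 * M - 2 = u := ⟨_, rfl⟩
      obtain ⟨v, hv⟩ : ∃ v, 5 * M - 2 = v := ⟨_, rfl⟩
      have hu0 : u ≠ 0 := hu ▸ h3.ne'
      have hv0 : v ≠ 0 := hv ▸ h5.ne'
      rw [hu, hv]
      field_simp
      rw [← hu, ← hv]
      ring
    have : 0 ≤ 2 * ((M - 1) * (5 * M - 2) - (d - 1) * (3 * M - 2)) /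
          ((3 * M - 2) * (5 * M - 2)) := by
      refine div_nonneg ?_ (by positivity)
      nlinarith [mul_le_mul_of_nonneg_right hdM h3.le, mul_nonneg (by linarith : 0 ≤ M - 2)
        (by linarith : 0 ≤ 2 * M - 1)]
    linarith
  refine key.trans_lt ?_
  gcongr

/-- Lemma `k=3 lemma`. -/
theorem k_eq_three_bound (d n σ : ℕ) (hd : 3 ≤ d) (hσ : σ < n)
    (hn : (3 : ℝ) / 4 * d * 2 ^ d - 2 * d < (n : ℝ) - (σ : ℝ))
    (Δ : ℝ) (hΔ : 0 < Δ) (hΔ' : Δ < (d : ℝ) / 3)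
    (di γi : ℝ)
    (hi : (di = (d : ℝ) + 2 ∧ γi = Δ / (5 * (2:ℝ) ^ ((d : ℝ) - 2) - 4)) ∨
      (di = (d : ℝ) - Δ ∧ γi = 0)) :
    ∃ δ K : ℝ, 0 < δ ∧ 0 < K ∧
      ∀ P : ℝ, 2 ≤ P →
        (∑' q : ℕ,
            if 0 < q ∧ P ^ γi ≤ etaOf d q ∧ etaOf d q ≤ P ^ gamOf d then
              ∫ α in {α : ℝ | α ∈ Set.Ico (0 : ℝ) 1 ∧
                  P ^ (-di) ≤ nint (q * α) ∧ nint (q * α) ≤ P ^ (-(xiOf d))},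
                (min ((etaOf d q)⁻¹) (nint (q * α) ^ (1 / (BkOf d 3 + VkOf d 3)))) ^
                  ((n : ℝ) - σ)
            else 0) ≤ K * P ^ (-(d : ℝ) - δ) := by
  obtain ⟨hM, hdM⟩ := two_rpow_natCast_sub_two hd
  rw [BkOf_add_VkOf_three, xiOf_eq]
  have hη3 := le_etaOf_rpow hd
  have h4 : (2 : ℝ) ^ d = 4 * 2 ^ ((d : ℝ) - 2) := by
    rw [← two_rpow_eq_four_mul, Real.rpow_natCast]
  rw [h4] at hn
  have hd' : (3 : ℝ) ≤ d := by exact_mod_cast hd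
  generalize (2 : ℝ) ^ ((d : ℝ) - 2) = M at *
  generalize (n : ℝ) - σ = N at *
  have h3 : 0 < 3 * M - 2 := by linarith
  have hN : d * (3 * M - 2) < N := by linarith
  obtain ⟨s, hs1, hs2⟩ : ∃ s, 3 * M - 2 < s ∧ s < N - (d - 1) * (3 * M - 2) :=
    exists_between (by linarith)
  have hx : ((d : ℝ) - 1) * (3 * M - 2) < N - s := by linarith
  have hsN : s ≤ N := by nlinarith
  have hsave := lt_saving_exponent hM hdM hx
  set ξ := (5 * M - 4) / (3 * M - 2)
  set e := 1 / (5 * M - 2)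
  have he : 0 ≤ e := one_div_nonneg.2 (by linarith)
  set a := s / (3 * M - 2)
  have ha : 1 < a := (one_lt_div h3).2 hs1
  have hsum := summable_bOf_c1Of_c2Of ha
  refine ⟨ξ * (1 + e * (N - s)) - d,
    4 * (∑' q : ℕ, ((bOf q : ℝ) * c1Of q * c2Of q) ^ (-a)) + 1, by linarith,
    by positivity, fun P hP => ?_⟩
  have hP0 : 0 < P := by linarith
  set f : ℕ → ℝ := fun q => if 0 < q ∧ P ^ γi ≤ etaOf d q ∧ etaOf d q ≤ P ^ gamOf d then
      ∫ α in {α : ℝ | α ∈ Set.Ico (0 : ℝ) 1 ∧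
          P ^ (-di) ≤ nint (q * α) ∧ nint (q * α) ≤ P ^ (-ξ)},
        (min ((etaOf d q)⁻¹) (nint (q * α) ^ e)) ^ N
    else 0
  have hpow : P ^ (-ξ) * (P ^ (-ξ)) ^ (e * (N - s)) =
      P ^ (-(d : ℝ) - (ξ * (1 + e * (N - s)) - d)) := by
    rw [← Real.rpow_mul hP0.le, ← Real.rpow_add hP0]
    congr 1
    ring
  set X := P ^ (-(d : ℝ) - (ξ * (1 + e * (N - s)) - d))
  have hX : 0 < X := by positivity
  have hf0 (q : ℕ) : 0 ≤ f q := by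
    dsimp only [f]
    split_ifs
    · refine integral_nonneg fun α => ?_
      have := nint_nonneg (q * α)
      have := etaOf_pos d q
      dsimp only [Pi.zero_apply]
      positivity
    · exact le_rfl
  have hfle (q : ℕ) : f q ≤ 4 * X * ((bOf q : ℝ) * c1Of q * c2Of q) ^ (-a) := by
    dsimp only [f]
    split_ifs with h
    · refine (integral_min_rpow_le h.1 (by positivity) (etaOf_pos d q) he (by linarith)
        hsN).trans ?_
      rw [hpow, ← mul_assoc]
      have hη := etaOf_pos d q
      have hb := bOf_pos q
      have hc1 := c1Of_pos q
      have hc2 := c2Of_pos q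
      gcongr
      calc etaOf d q ^ (-s) = (etaOf d q ^ (3 * M - 2)) ^ (-a) := by
            rw [← Real.rpow_mul hη.le, mul_neg, mul_div_cancel₀ _ h3.ne']
        _ ≤ _ := Real.rpow_le_rpow_of_nonpos (by positivity) (hη3 q) (by linarith)
    · positivity
  have hg := hsum.mul_left (4 * X)
  calc ∑' q, f q ≤ ∑' q : ℕ, 4 * X * ((bOf q : ℝ) * c1Of q * c2Of q) ^ (-a) :=
        (hg.of_nonneg_of_le hf0 hfle).tsum_le_tsum hfle hg
    _ = 4 * X * ∑' q : ℕ, ((bOf q : ℝ) * c1Of q * c2Of q) ^ (-a) := tsum_mul_left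
    _ ≤ _ := by linarith

end
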